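/- (Lemma 8, majorization rearrangement lemma.) Let f, g : ℝⁿ → [0,∞) be Borel measurable functions vanishing at infinity such that ∫_{B(r)} f*(x) dx ≤ ∫_{B(r)} g*(x) dx for all r ≥ 0. Then for every function h : ℝⁿ → [0,∞) of the form h(x) = H(‖x‖) with H : [0,∞) → [0,∞) non-increasing, it holds that ∫_{B(r)} h(x) f*(x) dx ≤ ∫_{B(r)} h(x) g*(x) dx for all r ≥ 0. -/

import Mathlib

open MeasureTheory

/-- The symmetric decreasing rearrangement of `f : ℝⁿ → [0,∞)`:
`f*(x) = ∫₀^∞ 1{vol({f > t}) > vₙ‖x‖ⁿ} dt`, where `vₙ` is the volume of the unit ball. -/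
noncomputable def symmDecRearrange (n : ℕ) (f : EuclideanSpace ℝ (Fin n) → ℝ)
    (x : EuclideanSpace ℝ (Fin n)) : ℝ :=
  ∫ t in Set.Ioi (0 : ℝ),
    if volume (Metric.ball (0 : EuclideanSpace ℝ (Fin n)) 1) * ENNReal.ofReal (‖x‖ ^ n)
        < volume {y | t < f y} then (1 : ℝ) else 0

lemma measurable_symmDecRearrange (n : ℕ) (f : EuclideanSpace ℝ (Fin n) → ℝ) :
    Measurable (symmDecRearrange n f) := by
  have hV : Measurable fun t : ℝ => volume {y | t < f y} := by
    apply Antitone.measurable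
    intro s t hst
    exact measure_mono fun y hy => lt_of_le_of_lt hst hy
  have hs : MeasurableSet {p : EuclideanSpace ℝ (Fin n) × ℝ |
      volume (Metric.ball (0 : EuclideanSpace ℝ (Fin n)) 1) * ENNReal.ofReal (‖p.1‖ ^ n)
        < volume {y | p.2 < f y}} := by
    refine measurableSet_lt ?_ (hV.comp measurable_snd)
    exact (ENNReal.measurable_ofReal.comp (measurable_fst.norm.pow_const n)).const_mul _
  have hm : Measurable fun p : EuclideanSpace ℝ (Fin n) × ℝ =>
      if volume (Metric.ball (0 : EuclideanSpace ℝ (Fin n)) 1) * ENNReal.ofReal (‖p.1‖ ^ n)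
        < volume {y | p.2 < f y} then (1 : ℝ) else 0 :=
    Measurable.ite hs measurable_const measurable_const
  exact (hm.stronglyMeasurable.integral_prod_right' (ν := volume.restrict (Set.Ioi 0))).measurable

lemma measure_le_of_closedBall_le {E : Type*} [NormedAddCommGroup E] [MeasurableSpace E]
    {μ ν : Measure E}
    (h : ∀ r : ℝ, μ (Metric.closedBall 0 r) ≤ ν (Metric.closedBall 0 r))
    {S : Set E} (hS : ∀ x ∈ S, ∀ y, ‖y‖ ≤ ‖x‖ → y ∈ S) : μ S ≤ ν S := by
  by_cases hmax : ∃ x ∈ S, ∀ y ∈ S, ‖y‖ ≤ ‖x‖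
  · obtain ⟨x, hx, hxmax⟩ := hmax
    have hball : S = Metric.closedBall 0 ‖x‖ := by
      ext y
      rw [mem_closedBall_zero_iff]
      exact ⟨hxmax y, hS x hx y⟩
    rw [hball]
    exact h _
  · push Not at hmax
    let I := {q : ℚ // ∃ y ∈ S, (q : ℝ) < ‖y‖}
    have hunion : S = ⋃ q : I, Metric.closedBall (0 : E) (q.1 : ℝ) := by
      ext x
      simp only [Set.mem_iUnion, mem_closedBall_zero_iff]
      constructor
      · intro hx
        obtain ⟨y, hy, hxy⟩ := hmax x hx
        obtain ⟨q, hq, hqy⟩ := exists_rat_btwn hxy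
        exact ⟨⟨q, y, hy, hqy⟩, hq.le⟩
      · rintro ⟨⟨q, y, hy, hqy⟩, hxq⟩
        exact hS y hy x (hxq.trans hqy.le)
    have hmono : Monotone fun q : I => Metric.closedBall (0 : E) (q.1 : ℝ) := fun p q hpq =>
      Metric.closedBall_subset_closedBall (Rat.cast_le.mpr hpq)
    rw [hunion, hmono.directed_le.measure_iUnion, hmono.directed_le.measure_iUnion]
    exact iSup_mono fun q => h _

/-- Majorization rearrangement lemma: if `∫_{B(r)} f* ≤ ∫_{B(r)} g*` for all `r ≥ 0`, then the
same holds after multiplying by any radially symmetric non-increasing non-negative `h`. -/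
theorem majorization_rearrangement (n : ℕ) (f g : EuclideanSpace ℝ (Fin n) → ℝ)
    (hf : Measurable f) (hg : Measurable g)
    (hf0 : ∀ x, 0 ≤ f x) (hg0 : ∀ x, 0 ≤ g x)
    (hfvanish : ∀ t : ℝ, 0 < t → volume {x | t < f x} < ⊤)
    (hgvanish : ∀ t : ℝ, 0 < t → volume {x | t < g x} < ⊤)
    (hmaj : ∀ r : ℝ, 0 ≤ r →
      ∫⁻ x in Metric.closedBall (0 : EuclideanSpace ℝ (Fin n)) r,
          ENNReal.ofReal (symmDecRearrange n f x) ≤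
        ∫⁻ x in Metric.closedBall (0 : EuclideanSpace ℝ (Fin n)) r,
          ENNReal.ofReal (symmDecRearrange n g x))
    (H : ℝ → ℝ) (hH0 : ∀ r, 0 ≤ H r)
    (hHanti : ∀ a b : ℝ, 0 ≤ a → a ≤ b → H b ≤ H a) :
    ∀ r : ℝ, 0 ≤ r →
      ∫⁻ x in Metric.closedBall (0 : EuclideanSpace ℝ (Fin n)) r,
          ENNReal.ofReal (H ‖x‖ * symmDecRearrange n f x) ≤
        ∫⁻ x in Metric.closedBall (0 : EuclideanSpace ℝ (Fin n)) r,
          ENNReal.ofReal (H ‖x‖ * symmDecRearrange n g x) := by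
  intro r _
  set F := fun x => ENNReal.ofReal (symmDecRearrange n f x)
  set G := fun x => ENNReal.ofReal (symmDecRearrange n g x)
  have hF : Measurable F := (measurable_symmDecRearrange n f).ennreal_ofReal
  have hG : Measurable G := (measurable_symmDecRearrange n g).ennreal_ofReal
  have hHm : Measurable fun x : EuclideanSpace ℝ (Fin n) => H ‖x‖ := by
    have hanti : Antitone fun s : ℝ => H (max s 0) := fun a b hab =>
      hHanti _ _ (le_max_right _ _) (max_le_max_right 0 hab)
    simpa [Function.comp_def] using hanti.measurable.comp
      (measurable_norm (α := EuclideanSpace ℝ (Fin n)))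
  have layer (k : EuclideanSpace ℝ (Fin n) → ℝ)
      (hk : Measurable fun x => ENNReal.ofReal (symmDecRearrange n k x)) :
      ∫⁻ x in Metric.closedBall (0 : EuclideanSpace ℝ (Fin n)) r,
          ENNReal.ofReal (H ‖x‖ * symmDecRearrange n k x) =
        ∫⁻ t in Set.Ioi (0 : ℝ),
          volume.withDensity (fun x => ENNReal.ofReal (symmDecRearrange n k x))
            ({x | t < H ‖x‖} ∩ Metric.closedBall 0 r) := by
    have hlt (t : ℝ) : MeasurableSet {x : EuclideanSpace ℝ (Fin n) | t < H ‖x‖} :=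
      measurableSet_lt measurable_const hHm
    simp_rw [← Measure.restrict_apply (hlt _)]
    rw [← lintegral_eq_lintegral_meas_lt _ (Filter.Eventually.of_forall fun x => hH0 _)
        hHm.aemeasurable,
      restrict_withDensity measurableSet_closedBall,
      lintegral_withDensity_eq_lintegral_mul _ hk hHm.ennreal_ofReal]
    refine lintegral_congr fun x => ?_
    rw [Pi.mul_apply, ENNReal.ofReal_mul (hH0 _), mul_comm]
  rw [layer f hF, layer g hG]
  refine lintegral_mono fun t => measure_le_of_closedBall_le (fun s => ?_) ?_
  · rcases lt_or_ge s 0 with hs | hs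
    · simp [Metric.closedBall_eq_empty.mpr hs]
    · rw [withDensity_apply _ measurableSet_closedBall,
        withDensity_apply _ measurableSet_closedBall]
      exact hmaj s hs
  · rintro x ⟨hxt, hxr⟩ y hyx
    rw [mem_closedBall_zero_iff] at hxr
    exact ⟨lt_of_lt_of_le hxt (hHanti _ _ (norm_nonneg y) hyx),
      mem_closedBall_zero_iff.mpr (hyx.trans hxr)⟩
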